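/- arXiv:2202.02150 — 2 statements merged into one kernel-verified Lean document; each statement's English description precedes it below -/
import Mathlib

section
/- Let m ≥ 1, let Σ ∈ ℝ^{m×m} be symmetric positive definite with eigendecomposition Σ = P diag(λ_1,…,λ_m) P^⊤, P orthogonal, and let e = (1/√m,…,1/√m)^⊤ and c = P^⊤ e. Let v be a multivariate Gaussian random vector on ℝ^m with mean 0 and covariance σ² Σ for some σ > 0, and let g = (g_1,…,g_m) be a standard Gaussian vector on ℝ^m. Then (e^⊤ v)² / ‖v‖² has the same distribution as (∑_{i=1}^m c_i λ_i^{1/2} g_i)² / (∑_{i=1}^m λ_i g_i²). Consequently, for any nonzero u ∈ ℝ^d, the stability statistic of the vectors v_1 u, …, v_m u has the same distribution as 1 − (∑_{i=1}^m c_i λ_i^{1/2} g_i)² / (∑_{i=1}^m λ_i g_i²). -/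
open MeasureTheory Matrix Filter

/-- Cramér–Wold characterization of the multivariate Gaussian law. -/
def IsGaussianVec {n : ℕ} (μ : Measure (Fin n → ℝ)) (mean : Fin n → ℝ)
    (cov : Matrix (Fin n) (Fin n) ℝ) : Prop :=
  ∀ u : Fin n → ℝ,
    μ.map (fun x => u ⬝ᵥ x) =
      ProbabilityTheory.gaussianReal (u ⬝ᵥ mean) (u ⬝ᵥ (cov *ᵥ u)).toNNReal

/-- The stability statistic `𝒱(v_1, …, v_m) = 1 - ‖m⁻¹ ∑ v_j‖² / (m⁻¹ ∑ ‖v_j‖²)`. -/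
noncomputable def Vstat {m d : ℕ} (v : Fin m → Fin d → ℝ) : ℝ :=
  1 - (∑ i, ((m : ℝ)⁻¹ * ∑ j, v j i) ^ 2) / ((m : ℝ)⁻¹ * ∑ j, ∑ i, v j i ^ 2)

theorem cramerWold_aux {n : ℕ} (μ ν : Measure (Fin n → ℝ)) [IsProbabilityMeasure μ]
    [IsProbabilityMeasure ν]
    (h : ∀ u : Fin n → ℝ, μ.map (fun x => u ⬝ᵥ x) = ν.map (fun x => u ⬝ᵥ x)) : μ = ν := by
  apply Measure.ext_of_charFunDual
  ext L
  rw [charFunDual_eq_charFun_map_one, charFunDual_eq_charFun_map_one]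
  have hL : (L : (Fin n → ℝ) → ℝ) = fun x => (fun i => L (Pi.single i 1)) ⬝ᵥ x := by
    funext x
    conv_lhs => rw [pi_eq_sum_univ' x]
    rw [map_sum]
    simp only [map_smul, smul_eq_mul, dotProduct]
    refine Finset.sum_congr rfl fun i _ => ?_
    rw [mul_comm]
  rw [hL, h]

theorem lam_nonneg_aux {m : ℕ} (Sgm Pm : Matrix (Fin m) (Fin m) ℝ) (hSgm : Sgm.PosDef)
    (hPm : Pmᵀ * Pm = 1) (lam : Fin m → ℝ)
    (hdecomp : Sgm = Pm * Matrix.diagonal lam * Pmᵀ) (i : Fin m) : 0 ≤ lam i := by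
  have h := hSgm.posSemidef.conjTranspose_mul_mul_same Pm
  have h2 : Pmᴴ * Sgm * Pm = Matrix.diagonal lam := by
    rw [hdecomp, conjTranspose_eq_transpose_of_trivial]
    calc Pmᵀ * (Pm * Matrix.diagonal lam * Pmᵀ) * Pm
        = (Pmᵀ * Pm) * Matrix.diagonal lam * (Pmᵀ * Pm) := by simp only [Matrix.mul_assoc]
      _ = _ := by simp [hPm]
  rw [h2] at h
  exact (posSemidef_diagonal_iff.1 h) i

theorem law_aux (m : ℕ)
    (Sgm : Matrix (Fin m) (Fin m) ℝ) (hSgm : Sgm.PosDef)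
    (Pm : Matrix (Fin m) (Fin m) ℝ) (hPm : Pmᵀ * Pm = 1)
    (lam : Fin m → ℝ) (hdecomp : Sgm = Pm * Matrix.diagonal lam * Pmᵀ)
    (σ : ℝ)
    (μv : Measure (Fin m → ℝ)) [IsProbabilityMeasure μv]
    (hv : IsGaussianVec μv 0 (σ ^ 2 • Sgm))
    (μg : Measure (Fin m → ℝ)) [IsProbabilityMeasure μg]
    (hg : IsGaussianVec μg 0 (1 : Matrix (Fin m) (Fin m) ℝ)) :
    μv = μg.map (fun g => σ • (Pm *ᵥ (fun i => Real.sqrt (lam i) * g i))) := by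
  have hmeas : Measurable (fun g : Fin m → ℝ =>
      σ • (Pm *ᵥ (fun i => Real.sqrt (lam i) * g i))) := by
    unfold Matrix.mulVec dotProduct
    fun_prop
  have : IsProbabilityMeasure
      (μg.map (fun g => σ • (Pm *ᵥ (fun i => Real.sqrt (lam i) * g i)))) :=
    Measure.isProbabilityMeasure_map hmeas.aemeasurable
  apply cramerWold_aux
  intro u
  rw [Measure.map_map (by unfold dotProduct; fun_prop) hmeas, hv u]
  have hcomp : ((fun x => u ⬝ᵥ x) ∘
      fun g : Fin m → ℝ => σ • (Pm *ᵥ (fun i => Real.sqrt (lam i) * g i))) =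
      fun g => (fun i => σ * ((Pmᵀ *ᵥ u) i * Real.sqrt (lam i))) ⬝ᵥ g := by
    funext g
    simp only [Function.comp, dotProduct_smul, dotProduct_mulVec, ← mulVec_transpose]
    simp only [dotProduct, smul_eq_mul, Finset.mul_sum]
    refine Finset.sum_congr rfl fun i _ => ?_
    ring
  rw [hcomp, hg]
  simp only [dotProduct_zero]
  congr 2
  rw [one_mulVec, hdecomp, smul_mulVec, dotProduct_smul, ← mulVec_mulVec, ← mulVec_mulVec,
    dotProduct_mulVec, ← mulVec_transpose]
  simp only [dotProduct, mulVec_diagonal, smul_eq_mul, Finset.mul_sum]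
  refine Finset.sum_congr rfl fun i _ => ?_
  have := Real.mul_self_sqrt (lam_nonneg_aux Sgm Pm hSgm hPm lam hdecomp i)
  generalize (Pmᵀ *ᵥ u) i = a
  nth_rewrite 1 [← this]
  ring

theorem Vstat_aux {m d : ℕ} (hm : 1 ≤ m) (u : Fin d → ℝ) (hu : u ≠ 0) (x : Fin m → ℝ) :
    Vstat (fun j i => x j * u i) =
      1 - ((fun _ : Fin m => (Real.sqrt m)⁻¹) ⬝ᵥ x) ^ 2 / ∑ i, x i ^ 2 := by
  have hm0 : (m : ℝ) ≠ 0 := by positivity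
  have hU : (∑ i, u i ^ 2) ≠ 0 := by
    intro h
    apply hu
    funext i
    have := (Finset.sum_eq_zero_iff_of_nonneg (fun i _ => sq_nonneg (u i))).1 h i
      (Finset.mem_univ i)
    simpa using this
  unfold Vstat
  have h1 : ∑ i, ((m : ℝ)⁻¹ * ∑ j, x j * u i) ^ 2 =
      ((m : ℝ)⁻¹ * ∑ i, u i ^ 2) * ((m : ℝ)⁻¹ * (∑ j, x j) ^ 2) := by
    simp only [← Finset.sum_mul, mul_pow, ← Finset.mul_sum]
    ring
  have h2 : (m : ℝ)⁻¹ * ∑ j, ∑ i, (x j * u i) ^ 2 =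
      ((m : ℝ)⁻¹ * ∑ i, u i ^ 2) * ∑ j, x j ^ 2 := by
    simp only [mul_pow, ← Finset.mul_sum, ← Finset.sum_mul]
    ring
  have h3 : ((fun _ : Fin m => (Real.sqrt m)⁻¹) ⬝ᵥ x) ^ 2 = (m : ℝ)⁻¹ * (∑ j, x j) ^ 2 := by
    simp only [dotProduct, ← Finset.mul_sum, mul_pow, inv_pow]
    rw [Real.sq_sqrt (Nat.cast_nonneg m)]
  rw [h1, h2, h3, mul_div_mul_left _ _ (mul_ne_zero (inv_ne_zero hm0) hU)]

theorem ratio_aux (m : ℕ) (e : Fin m → ℝ)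
    (Pm : Matrix (Fin m) (Fin m) ℝ) (hPm : Pmᵀ * Pm = 1)
    (lam : Fin m → ℝ) (hl : ∀ i, 0 ≤ lam i) (σ : ℝ) (hσ : 0 < σ) (g : Fin m → ℝ) :
    (e ⬝ᵥ (σ • (Pm *ᵥ (fun i => Real.sqrt (lam i) * g i)))) ^ 2 /
      ∑ i, (σ • (Pm *ᵥ (fun i => Real.sqrt (lam i) * g i))) i ^ 2 =
    (∑ i, (Pmᵀ *ᵥ e) i * Real.sqrt (lam i) * g i) ^ 2 / ∑ i, lam i * g i ^ 2 := by
  have h1 : e ⬝ᵥ (σ • (Pm *ᵥ (fun i => Real.sqrt (lam i) * g i))) =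
      σ * ∑ i, (Pmᵀ *ᵥ e) i * Real.sqrt (lam i) * g i := by
    rw [dotProduct_smul, dotProduct_mulVec, ← mulVec_transpose]
    simp only [dotProduct, smul_eq_mul, mul_assoc]
  have h2 : ∑ i, (σ • (Pm *ᵥ (fun i => Real.sqrt (lam i) * g i))) i ^ 2 =
      σ ^ 2 * ∑ i, lam i * g i ^ 2 := by
    set w : Fin m → ℝ := fun i => Real.sqrt (lam i) * g i with hw
    have h3 : (Pm *ᵥ w) ⬝ᵥ (Pm *ᵥ w) = w ⬝ᵥ w := by
      rw [dotProduct_mulVec, ← mulVec_transpose, mulVec_mulVec, hPm, one_mulVec]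
    have h4 : w ⬝ᵥ w = ∑ i, lam i * g i ^ 2 := by
      refine Finset.sum_congr rfl fun i _ => ?_
      simp only [hw]
      nth_rewrite 3 [← Real.mul_self_sqrt (hl i)]
      ring
    rw [← h4, ← h3]
    simp only [dotProduct, Pi.smul_apply, smul_eq_mul, mul_pow, Finset.mul_sum]
    refine Finset.sum_congr rfl fun i _ => ?_
    ring
  rw [h1, h2, mul_pow, mul_div_mul_left _ _ (by positivity)]

/-- with `v ~ N(0, σ²Σ)`, `Σ = P diag(λ) Pᵀ` (`P` orthogonal, `Σ` positive
definite), `e = (1/√m, …, 1/√m)ᵀ`, `c = Pᵀe` and `g` standard Gaussian,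
`(e⊤v)²/‖v‖²` is distributed as `(∑ c_i √λ_i g_i)²/(∑ λ_i g_i²)`; consequently, for any
nonzero `u ∈ ℝ^d`, the stability statistic of `v_1 u, …, v_m u` is distributed as
`1 - (∑ c_i √λ_i g_i)²/(∑ λ_i g_i²)`. -/
theorem stmt_2 (m : ℕ) (hm : 1 ≤ m)
    (Sgm : Matrix (Fin m) (Fin m) ℝ) (hSgm : Sgm.PosDef)
    (Pm : Matrix (Fin m) (Fin m) ℝ) (hPm : Pmᵀ * Pm = 1)
    (lam : Fin m → ℝ) (hdecomp : Sgm = Pm * Matrix.diagonal lam * Pmᵀ)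
    (σ : ℝ) (hσ : 0 < σ)
    (μv : Measure (Fin m → ℝ)) [IsProbabilityMeasure μv]
    (hv : IsGaussianVec μv 0 (σ ^ 2 • Sgm))
    (μg : Measure (Fin m → ℝ)) [IsProbabilityMeasure μg]
    (hg : IsGaussianVec μg 0 (1 : Matrix (Fin m) (Fin m) ℝ)) :
    (μv.map (fun x => ((fun _ : Fin m => (Real.sqrt m)⁻¹) ⬝ᵥ x) ^ 2 / ∑ i, x i ^ 2)
      = μg.map (fun g =>
          (∑ i, (Pmᵀ *ᵥ fun _ : Fin m => (Real.sqrt m)⁻¹) i * Real.sqrt (lam i) * g i) ^ 2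
            / ∑ i, lam i * g i ^ 2))
    ∧ ∀ (d : ℕ) (u : Fin d → ℝ), u ≠ 0 →
        μv.map (fun x => Vstat (fun j i => x j * u i))
          = μg.map (fun g => 1 -
              (∑ i, (Pmᵀ *ᵥ fun _ : Fin m => (Real.sqrt m)⁻¹) i * Real.sqrt (lam i) * g i) ^ 2
                / ∑ i, lam i * g i ^ 2) := by
  have hl := lam_nonneg_aux Sgm Pm hSgm hPm lam hdecomp
  have hlaw := law_aux m Sgm hSgm Pm hPm lam hdecomp σ μv hv μg hg
  have hmeas : Measurable (fun g : Fin m → ℝ =>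
      σ • (Pm *ᵥ (fun i => Real.sqrt (lam i) * g i))) := by
    unfold Matrix.mulVec dotProduct
    fun_prop
  constructor
  · rw [hlaw, Measure.map_map (by unfold dotProduct; fun_prop) hmeas]
    congr 1
    funext g
    exact ratio_aux m _ Pm hPm lam hl σ hσ g
  · intro d u hu
    simp only [Vstat_aux hm u hu]
    rw [hlaw, Measure.map_map (by unfold dotProduct; fun_prop) hmeas]
    congr 1
    funext g
    exact congrArg (fun t => 1 - t) (ratio_aux m _ Pm hPm lam hl σ hσ g)
end

section
/- Validity of the permutation test up to the prediction error. Let ℓ, q, M ≥ 1, σ_y > 0, let W ∈ ℝ^{ℓ×q} be a fixed matrix, γ, γ̂ ∈ ℝ^q fixed vectors, and let T : ℝ^ℓ → ℝ be any measurable function. Let N ~ N(0, σ_y² I_ℓ) and set Y = Wγ + N (the null model, β = 0). Let π_1,…,π_M be permutations of {1,…,ℓ} drawn independently and uniformly at random, independent of N, with permutation matrices P_1,…,P_M, and set Ŷ(π_i) = Wγ̂ + P_i (Y − Wγ̂). Define the p-value p = (∑_{i=1}^M 1{T(Ŷ(π_i)) ≥ T(Y)} + 1)/(M+1). Then for every α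 ∈ [0,1], P(p ≤ α) ≤ α + √M ‖W(γ − γ̂)‖ / (2 σ_y). -/
open MeasureTheory Matrix Filter

/-- The permutation group of a finite set carries the discrete σ-algebra. -/
instance (n : ℕ) : MeasurableSpace (Equiv.Perm (Fin n)) := ⊤

section helpers
open ProbabilityTheory

/-- Cramér–Wold. -/
lemma cramer_wold {n : ℕ} (μ μ' : Measure (Fin n → ℝ)) [IsFiniteMeasure μ] [IsFiniteMeasure μ']
    (h : ∀ u : Fin n → ℝ, μ.map (fun x => u ⬝ᵥ x) = μ'.map (fun x => u ⬝ᵥ x)) : μ = μ' := by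
  apply Measure.ext_of_charFunDual
  ext L
  rw [charFunDual_eq_charFun_map_one, charFunDual_eq_charFun_map_one]
  have hL : (L : (Fin n → ℝ) → ℝ) = fun x => (fun i => L (Pi.single i 1)) ⬝ᵥ x := by
    funext x
    have hx : x = ∑ i, x i • (Pi.single i 1 : Fin n → ℝ) := by
      rw [pi_eq_sum_univ' x]
      simp [Pi.single, Function.update]
    conv_lhs => rw [hx]
    simp [dotProduct, mul_comm]
  rw [hL, h]

lemma gauss_var {n : ℕ} (σ : ℝ) (u : Fin n → ℝ) :
    (((u ⬝ᵥ ((σ ^ 2 • (1 : Matrix (Fin n) (Fin n) ℝ)) *ᵥ u)).toNNReal : NNReal) : ℝ)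
      = σ ^ 2 * (u ⬝ᵥ u) := by
  rw [Matrix.smul_mulVec, Matrix.one_mulVec, dotProduct_smul, smul_eq_mul]
  refine Real.coe_toNNReal _ (mul_nonneg (sq_nonneg _) ?_)
  exact Finset.sum_nonneg fun i _ => mul_self_nonneg _

section gauss
variable {n : ℕ} {σ : ℝ} {ν : Measure (Fin n → ℝ)} [IsProbabilityMeasure ν]
  (hν : IsGaussianVec ν 0 (σ ^ 2 • (1 : Matrix (Fin n) (Fin n) ℝ)))

lemma meas_dot (u : Fin n → ℝ) : Measurable (fun x : Fin n → ℝ => u ⬝ᵥ x) := by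
  unfold dotProduct
  fun_prop

lemma gauss_integrable
    (hν : IsGaussianVec ν 0 (σ ^ 2 • (1 : Matrix (Fin n) (Fin n) ℝ))) (u : Fin n → ℝ) :
    Integrable (fun x => Real.exp (u ⬝ᵥ x)) ν := by
  have h := integrable_exp_mul_gaussianReal (μ := u ⬝ᵥ 0)
    (v := (u ⬝ᵥ ((σ ^ 2 • (1 : Matrix (Fin n) (Fin n) ℝ)) *ᵥ u)).toNNReal) 1
  rw [← hν u] at h
  have := h.comp_measurable (meas_dot u)
  simpa [Function.comp_def] using this

lemma gauss_integral
    (hν : IsGaussianVec ν 0 (σ ^ 2 • (1 : Matrix (Fin n) (Fin n) ℝ))) (u : Fin n → ℝ) :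
    ∫ x, Real.exp (u ⬝ᵥ x) ∂ν = Real.exp (σ ^ 2 * (u ⬝ᵥ u) / 2) := by
  have h := mgf_gaussianReal (hν u) 1
  rw [gauss_var] at h
  simpa [mgf] using h

/-- the shifted Gaussian is an exponential tilt. -/
lemma gauss_shift (hσ : 0 < σ)
    (hν : IsGaussianVec ν 0 (σ ^ 2 • (1 : Matrix (Fin n) (Fin n) ℝ))) (d : Fin n → ℝ) :
    ν.map (fun x => d + x) = ν.tilted (fun x => ((σ ^ 2)⁻¹ • d) ⬝ᵥ x) := by
  have hσ2 : σ ^ 2 ≠ 0 := by positivity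
  have hm : Measurable (fun x : Fin n → ℝ => d + x) := by fun_prop
  have : IsProbabilityMeasure (ν.tilted (fun x => ((σ ^ 2)⁻¹ • d) ⬝ᵥ x)) :=
    isProbabilityMeasure_tilted (gauss_integrable hν _)
  have : IsProbabilityMeasure (ν.map (fun x => d + x)) :=
    Measure.isProbabilityMeasure_map hm.aemeasurable
  apply cramer_wold
  intro u
  have h1 (s : ℝ) : mgf (fun x => u ⬝ᵥ x) (ν.map (fun x => d + x)) s
      = Real.exp (s * (u ⬝ᵥ d) + s ^ 2 * (σ ^ 2 * (u ⬝ᵥ u)) / 2) := by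
    have hsm : Measurable (fun x : Fin n → ℝ => Real.exp (s * (u ⬝ᵥ x))) :=
      Real.measurable_exp.comp ((meas_dot u).const_mul s)
    rw [mgf, integral_map hm.aemeasurable hsm.aestronglyMeasurable]
    have : ∀ x, Real.exp (s * (u ⬝ᵥ (d + x)))
        = Real.exp (s * (u ⬝ᵥ d)) * Real.exp ((s • u) ⬝ᵥ x) := by
      intro x
      rw [← Real.exp_add, dotProduct_add, smul_dotProduct, smul_eq_mul]
      ring_nf
    simp_rw [this]
    rw [integral_const_mul, gauss_integral hν, ← Real.exp_add]
    simp only [smul_dotProduct, dotProduct_smul, smul_eq_mul]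
    ring_nf
  have h2 (s : ℝ) : mgf (fun x => u ⬝ᵥ x) (ν.tilted (fun x => ((σ ^ 2)⁻¹ • d) ⬝ᵥ x)) s
      = Real.exp (s * (u ⬝ᵥ d) + s ^ 2 * (σ ^ 2 * (u ⬝ᵥ u)) / 2) := by
    rw [mgf, integral_exp_tilted, gauss_integral hν]
    have : ∀ x, ((fun x => ((σ ^ 2)⁻¹ • d) ⬝ᵥ x) + fun x => s * u ⬝ᵥ x) x
        = ((σ ^ 2)⁻¹ • d + s • u) ⬝ᵥ x := by
      intro x
      simp [add_dotProduct]
    simp_rw [this]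
    rw [gauss_integral hν, ← Real.exp_sub]
    simp only [smul_dotProduct, dotProduct_smul, smul_eq_mul, add_dotProduct, dotProduct_add,
      dotProduct_comm d u]
    congr 1
    field_simp
    ring
  have hmgf : mgf (fun x => u ⬝ᵥ x) (ν.map (fun x => d + x))
      = mgf (fun x => u ⬝ᵥ x) (ν.tilted (fun x => ((σ ^ 2)⁻¹ • d) ⬝ᵥ x)) := by
    funext s
    rw [h1, h2]
  apply Measure.ext_of_complexMGF_eq (meas_dot u).aemeasurable (meas_dot u).aemeasurable
  funext z
  apply eqOn_complexMGF_of_mgf hmgf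
  have : integrableExpSet (fun x => u ⬝ᵥ x) (ν.map (fun x => d + x)) = Set.univ := by
    ext s
    simp only [integrableExpSet, Set.mem_ofPred_eq, Set.mem_univ, iff_true]
    rw [← mgf_pos_iff, h1]
    positivity
  simp [this]

lemma gauss_tv (hσ : 0 < σ)
    (hν : IsGaussianVec ν 0 (σ ^ 2 • (1 : Matrix (Fin n) (Fin n) ℝ))) (d : Fin n → ℝ)
    {B : Set (Fin n → ℝ)} (hB : MeasurableSet B) :
    ν.real {x | d + x ∈ B} ≤ ν.real B + Real.sqrt (∑ j, d j ^ 2) / (2 * σ) := by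
  have hdd : d ⬝ᵥ d = ∑ j, d j ^ 2 := by simp [dotProduct, sq]
  rw [← hdd]
  have hdn : 0 ≤ d ⬝ᵥ d := by rw [hdd]; positivity
  rcases hdn.eq_or_lt with h0 | hpos
  · have : d = 0 := dotProduct_self_eq_zero.1 h0.symm
    subst this
    simp
  set t := Real.sqrt (d ⬝ᵥ d) / σ with ht
  have htpos : 0 < t := div_pos (Real.sqrt_pos.2 hpos) hσ
  have ht2 : t ^ 2 = (d ⬝ᵥ d) / σ ^ 2 := by rw [ht, div_pow, Real.sq_sqrt hdn]
  have hgoal : Real.sqrt (d ⬝ᵥ d) / (2 * σ) = t / 2 := by rw [ht]; field_simp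
  rw [hgoal]
  set a : Fin n → ℝ := (σ ^ 2)⁻¹ • d with ha
  set L : (Fin n → ℝ) → ℝ := fun x => Real.exp (-(t ^ 2 / 2)) * Real.exp (a ⬝ᵥ x) with hL
  set R : (Fin n → ℝ) → ℝ :=
    fun x => Real.exp (-(t ^ 2 / 4)) * Real.exp (((1 / 2 : ℝ) • a) ⬝ᵥ x) with hR
  have hRL : ∀ x, R x ^ 2 = L x := by
    intro x
    simp only [hR, hL, mul_pow, ← Real.exp_nat_mul, smul_dotProduct, smul_eq_mul]
    congr 2 <;> push_cast <;> ring
  have hσ2 : σ ^ 2 ≠ 0 := by positivity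
  have haa : σ ^ 2 * (a ⬝ᵥ a) = t ^ 2 := by
    rw [ha, ht2]; simp only [smul_dotProduct, dotProduct_smul, smul_eq_mul]; field_simp
  have iL : Integrable L ν := (gauss_integrable hν a).const_mul _
  have iR : Integrable R ν := (gauss_integrable hν _).const_mul _
  have eL : ∫ x, L x ∂ν = 1 := by
    simp only [hL]
    rw [integral_const_mul, gauss_integral hν, haa, ← Real.exp_add]
    simp
  have eR : ∫ x, R x ∂ν = Real.exp (-(t ^ 2 / 8)) := by
    simp only [hR]
    rw [integral_const_mul, gauss_integral hν, ← Real.exp_add]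
    simp only [smul_dotProduct, dotProduct_smul, smul_eq_mul]
    congr 1
    linear_combination (1 / 8) * haa
  have hmeas : ν.real {x | d + x ∈ B} = ∫ x in B, L x ∂ν := by
    have hm : Measurable (fun x : Fin n → ℝ => d + x) := by fun_prop
    have h1 : ν {x | d + x ∈ B} = ν.map (fun x => d + x) B := by
      rw [Measure.map_apply hm hB]; rfl
    rw [Measure.real, h1, gauss_shift hσ hν d, tilted_apply_eq_ofReal_integral' _ hB,
      gauss_integral hν, ← ha, haa]
    have : ∀ x, Real.exp (a ⬝ᵥ x) / Real.exp (t ^ 2 / 2) = L x := by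
      intro x
      simp only [hL, Real.exp_neg]
      field_simp
    simp_rw [this]
    refine ENNReal.toReal_ofReal (integral_nonneg fun x => ?_)
    simp only [hL, Pi.zero_apply]; positivity
  rw [hmeas]
  clear_value L R
  have hB1 : ν.real B = ∫ x in B, (1 : ℝ) ∂ν := by simp
  have key : ∫ x in B, L x ∂ν - ∫ x in B, (1 : ℝ) ∂ν ≤
      ∫ x, ((L x - 1) / 2 + (1 / 4) * ((t / 4) * (L x + 2 * R x + 1)
        + (4 / t) * (L x - 2 * R x + 1))) ∂ν := by
    rw [← integral_sub iL.integrableOn (integrable_const _), ← integral_indicator hB]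
    apply integral_mono
    · exact (iL.sub (integrable_const _)).indicator hB
    · fun_prop
    · intro x
      have hc : |L x - 1| ≤ (1 / 2) * ((t / 4) * (L x + 2 * R x + 1)
        + (4 / t) * (L x - 2 * R x + 1)) := by
        have e1 : L x - 1 = (R x - 1) * (R x + 1) := by rw [← hRL]; ring
        have hc0 : (t / 4) * (4 / t) = 1 := by field_simp
        have hp : 0 < t / 4 := by positivity
        have hq : 0 < 4 / t := by positivity
        generalize t / 4 = c at *
        generalize 4 / t = e at *
        rw [← hRL] at *
        have s1 : 0 ≤ e * (c * (R x + 1) + (R x - 1)) ^ 2 := by positivity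
        have s2 : 0 ≤ e * (c * (R x + 1) - (R x - 1)) ^ 2 := by positivity
        have q1 : e * (c * (R x + 1) + (R x - 1)) ^ 2
            = c * (R x + 1) ^ 2 + 2 * (R x + 1) * (R x - 1) + e * (R x - 1) ^ 2 := by
          linear_combination (c * (R x + 1) ^ 2 + 2 * (R x + 1) * (R x - 1)) * hc0
        have q2 : e * (c * (R x + 1) - (R x - 1)) ^ 2
            = c * (R x + 1) ^ 2 - 2 * (R x + 1) * (R x - 1) + e * (R x - 1) ^ 2 := by
          linear_combination (c * (R x + 1) ^ 2 - 2 * (R x + 1) * (R x - 1)) * hc0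
        rw [abs_le]
        constructor <;> nlinarith
      have := abs_le.1 hc
      by_cases hx : x ∈ B
      · simp only [hx, Set.indicator_of_mem]; linarith
      · simp only [hx, not_false_eq_true, Set.indicator_of_notMem]; linarith
  have hval : ∫ x, ((L x - 1) / 2 + (1 / 4) * ((t / 4) * (L x + 2 * R x + 1)
        + (4 / t) * (L x - 2 * R x + 1))) ∂ν
      = (1 / 4) * ((t / 4) * (2 + 2 * Real.exp (-(t ^ 2 / 8)))
        + (4 / t) * (2 - 2 * Real.exp (-(t ^ 2 / 8)))) := by
    have : ∀ x, ((L x - 1) / 2 + (1 / 4) * ((t / 4) * (L x + 2 * R x + 1)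
        + (4 / t) * (L x - 2 * R x + 1)))
        = (1 / 2 + t / 16 + 1 / t) * L x + (t / 8 - 2 / t) * R x + (t / 16 + 1 / t - 1 / 2) := by
      intro x; field_simp; ring
    simp_rw [this]
    rw [integral_add (by fun_prop) (by fun_prop), integral_add (by fun_prop) (by fun_prop),
      integral_const_mul, integral_const_mul, eL, eR]
    simp
    field_simp
    ring
  have hρ1 : 1 - t ^ 2 / 8 ≤ Real.exp (-(t ^ 2 / 8)) := by
    have := Real.add_one_le_exp (-(t ^ 2 / 8)); linarith
  have hρ2 : Real.exp (-(t ^ 2 / 8)) ≤ 1 := Real.exp_le_one_iff.2 (by nlinarith [sq_nonneg t])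
  have b1 : (t / 4) * (2 + 2 * Real.exp (-(t ^ 2 / 8))) ≤ t / 4 * 4 := by
    gcongr; linarith
  have b2 : (4 / t) * (2 - 2 * Real.exp (-(t ^ 2 / 8))) ≤ (4 / t) * (t ^ 2 / 4) := by
    gcongr; linarith
  have b3 : (4 / t) * (t ^ 2 / 4) = t := by field_simp
  rw [hB1]
  linarith

/-- permutation invariance -/
lemma gauss_perm
    (hν : IsGaussianVec ν 0 (σ ^ 2 • (1 : Matrix (Fin n) (Fin n) ℝ))) (g : Equiv.Perm (Fin n)) :
    ν.map (fun x j => x (g j)) = ν := by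
  have hm : Measurable (fun (x : Fin n → ℝ) j => x (g j)) := by fun_prop
  have : IsProbabilityMeasure (ν.map (fun x j => x (g j))) :=
    Measure.isProbabilityMeasure_map hm.aemeasurable
  apply cramer_wold
  intro u
  rw [Measure.map_map (meas_dot u) hm]
  have h1 : ((fun x => u ⬝ᵥ x) ∘ fun (x : Fin n → ℝ) j => x (g j))
      = fun x => (fun j => u (g.symm j)) ⬝ᵥ x := by
    funext x
    simp only [Function.comp, dotProduct]
    rw [← Equiv.sum_comp g (fun i => u (g.symm i) * x i)]
    simp
  rw [h1, hν, hν]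
  congr 1
  · simp
  · rw [← NNReal.coe_inj, gauss_var, gauss_var]
    congr 1
    simp only [dotProduct]
    exact Equiv.sum_comp g.symm (fun j => u j * u j)
end gauss

lemma rank_count {ι : Type*} [Fintype ι] (a : ι → ℝ) (c : ℝ) (hc : 0 ≤ c) :
    ((Finset.univ.filter fun k =>
      ((Finset.univ.filter fun i => a k ≤ a i).card : ℝ) ≤ c).card : ℝ) ≤ c := by
  set K := Finset.univ.filter fun k =>
      ((Finset.univ.filter fun i => a k ≤ a i).card : ℝ) ≤ c with hK
  rcases K.eq_empty_or_nonempty with h | h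
  · rw [h]; simpa using hc
  · obtain ⟨k, hk, hmin⟩ := K.exists_min_image a h
    have h1 : ((Finset.univ.filter fun i => a k ≤ a i).card : ℝ) ≤ c := by
      rw [hK, Finset.mem_filter] at hk
      exact hk.2
    refine le_trans ?_ h1
    exact_mod_cast Finset.card_le_card fun i hi => by simpa using hmin i hi

lemma sym_count {G : Type*} [Fintype G] (M : ℕ) (a : G → ℝ) (c : ℝ) (hc : 0 ≤ c) :
    ((M : ℝ) + 1) * ∑ τ : Fin (M + 1) → G,
      (if ((Finset.univ.filter fun i => a (τ 0) ≤ a (τ i)).card : ℝ) ≤ c then (1 : ℝ) else 0)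
      ≤ c * (Fintype.card G : ℝ) ^ (M + 1) := by
  classical
  have hk : ∀ k : Fin (M + 1), ∑ τ : Fin (M + 1) → G,
      (if ((Finset.univ.filter fun i => a (τ k) ≤ a (τ i)).card : ℝ) ≤ c then (1 : ℝ) else 0)
      = ∑ τ : Fin (M + 1) → G,
      (if ((Finset.univ.filter fun i => a (τ 0) ≤ a (τ i)).card : ℝ) ≤ c then (1 : ℝ) else 0) := by
    intro k
    rw [← Equiv.sum_comp (Equiv.arrowCongr (Equiv.swap 0 k) (Equiv.refl G))]
    refine Finset.sum_congr rfl fun τ _ => ?_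
    have e : (Finset.univ.filter fun i => a (τ 0) ≤ a (τ (Equiv.swap 0 k i))).card
        = (Finset.univ.filter fun i => a (τ 0) ≤ a (τ i)).card := by
      apply Finset.card_equiv (Equiv.swap 0 k)
      intro i
      simp
    simp [Equiv.arrowCongr, e]
  have hs : ((M : ℝ) + 1) * ∑ τ : Fin (M + 1) → G,
      (if ((Finset.univ.filter fun i => a (τ 0) ≤ a (τ i)).card : ℝ) ≤ c then (1 : ℝ) else 0)
      = ∑ k : Fin (M + 1), ∑ τ : Fin (M + 1) → G,
      (if ((Finset.univ.filter fun i => a (τ k) ≤ a (τ i)).card : ℝ) ≤ c then (1 : ℝ) else 0) := by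
    rw [Finset.sum_congr rfl fun k _ => hk k]
    simp
  rw [hs, Finset.sum_comm]
  calc _ ≤ ∑ τ : Fin (M + 1) → G, c := by
        refine Finset.sum_le_sum fun τ _ => ?_
        have := rank_count (fun i => a (τ i)) c hc
        rw [Finset.sum_boole]
        exact this
    _ = _ := by simp [mul_comm]

lemma group_count {G : Type*} [Group G] [Fintype G] (M : ℕ) (a : G → ℝ) (c : ℝ) (hc : 0 ≤ c) :
    ((M : ℝ) + 1) * ∑ g : G, ∑ π : Fin M → G,
      (if ((Finset.univ.filter fun i => a g ≤ a (g * π i)).card : ℝ) + 1 ≤ c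
        then (1 : ℝ) else 0)
      ≤ c * (Fintype.card G : ℝ) ^ (M + 1) := by
  classical
  refine le_trans (le_of_eq ?_) (sym_count M a c hc)
  congr 1
  rw [← Equiv.sum_comp (Fin.consEquiv (fun _ : Fin (M + 1) => G)), Fintype.sum_prod_type]
  refine Finset.sum_congr rfl fun g _ => ?_
  rw [← Equiv.sum_comp (Equiv.piCongrRight fun _ : Fin M => Equiv.mulLeft g⁻¹)]
  refine Finset.sum_congr rfl fun π _ => ?_
  congr 1
  rw [Fin.card_filter_univ_succ]
  simp [Fin.consEquiv]

lemma perm_valid {n : ℕ} (M : ℕ) {ν : Measure (Fin n → ℝ)} [IsProbabilityMeasure ν]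
    (hinv : ∀ g : Equiv.Perm (Fin n), ν.map (fun x j => x (g j)) = ν)
    (B : (Fin M → Equiv.Perm (Fin n)) → Set (Fin n → ℝ)) (hB : ∀ π, MeasurableSet (B π))
    (S : (Fin n → ℝ) → ℝ) (c : ℝ) (hc : 0 ≤ c)
    (hBS : ∀ π z, z ∈ B π ↔
      ((Finset.univ.filter fun i => S z ≤ S (fun j => z (π i j))).card : ℝ) + 1 ≤ c) :
    ((M : ℝ) + 1) * ∑ π, ν.real (B π) ≤ c * (Fintype.card (Equiv.Perm (Fin n)) : ℝ) ^ M := by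
  classical
  have hm : ∀ g : Equiv.Perm (Fin n), Measurable (fun (x : Fin n → ℝ) j => x (g j)) := by
    intro g; fun_prop
  have h1 : ∀ (g : Equiv.Perm (Fin n)) π, ν.real (B π)
      = ∫ z, (if (fun j => z (g j)) ∈ B π then (1 : ℝ) else 0) ∂ν := by
    intro g π
    have e : ν.real (B π) = ν.real ((fun (x : Fin n → ℝ) j => x (g j)) ⁻¹' B π) := by
      conv_lhs => rw [← hinv g]
      rw [Measure.real, Measure.map_apply (hm g) (hB π), Measure.real]
    rw [e, ← integral_indicator_one (hm g (hB π))]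
    rfl
  have hint : ∀ (g : Equiv.Perm (Fin n)) π,
      Integrable (fun z => (if (fun j => z (g j)) ∈ B π then (1 : ℝ) else 0)) ν := by
    intro g π
    have : Integrable (((fun (x : Fin n → ℝ) j => x (g j)) ⁻¹' B π).indicator
      (fun _ => (1 : ℝ))) ν := (integrable_const (1 : ℝ)).indicator (hm g (hB π))
    exact this
  have h2 : (Fintype.card (Equiv.Perm (Fin n)) : ℝ) * ∑ π, ν.real (B π)
      = ∫ z, ∑ g : Equiv.Perm (Fin n), ∑ π,
        (if (fun j => z (g j)) ∈ B π then (1 : ℝ) else 0) ∂ν := by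
    rw [integral_finsetSum _ fun g _ => integrable_finsetSum _ fun π _ => hint g π]
    have : ∀ g : Equiv.Perm (Fin n), ∫ z, ∑ π,
        (if (fun j => z (g j)) ∈ B π then (1 : ℝ) else 0) ∂ν = ∑ π, ν.real (B π) := by
      intro g
      rw [integral_finsetSum _ fun π _ => hint g π]
      exact Finset.sum_congr rfl fun π _ => (h1 g π).symm
    simp only [this, Finset.sum_const, Finset.card_univ, nsmul_eq_mul]
  have h3 : ((M : ℝ) + 1) * ∫ z, ∑ g : Equiv.Perm (Fin n), ∑ π,
        (if (fun j => z (g j)) ∈ B π then (1 : ℝ) else 0) ∂ν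
      ≤ c * (Fintype.card (Equiv.Perm (Fin n)) : ℝ) ^ (M + 1) := by
    rw [← integral_const_mul]
    calc _ ≤ ∫ z, c * (Fintype.card (Equiv.Perm (Fin n)) : ℝ) ^ (M + 1) ∂ν := by
          refine integral_mono (Integrable.const_mul (integrable_finsetSum _ fun g _ =>
            integrable_finsetSum _ fun π _ => hint g π) _) (integrable_const _) fun z => ?_
          have := group_count M (fun g : Equiv.Perm (Fin n) => S (fun j => z (g j))) c hc
          simp only [hBS]
          exact this
      _ = _ := by simp
  rw [← h2] at h3
  have hpos : (0 : ℝ) < Fintype.card (Equiv.Perm (Fin n)) := by exact_mod_cast Fintype.card_pos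
  rw [pow_succ] at h3
  refine le_of_mul_le_mul_left ?_ hpos
  linarith

lemma prod_bound {n M : ℕ} (ν : Measure (Fin n → ℝ)) [IsProbabilityMeasure ν]
    (A : Set ((Fin n → ℝ) × (Fin M → Equiv.Perm (Fin n)))) :
    ((ν.prod (Measure.pi fun _ : Fin M =>
      (PMF.uniformOfFintype (Equiv.Perm (Fin n))).toMeasure)) A).toReal
    ≤ (∑ π, ν.real {z | (z, π) ∈ A}) / (Fintype.card (Equiv.Perm (Fin n)) : ℝ) ^ M := by
  classical
  set Q := (Measure.pi fun _ : Fin M =>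
      (PMF.uniformOfFintype (Equiv.Perm (Fin n))).toMeasure) with hQ
  have hd : DiscreteMeasurableSpace (Equiv.Perm (Fin n)) := ⟨fun _ => trivial⟩
  have hA : A = ⋃ π, {z | (z, π) ∈ A} ×ˢ {π} := by
    ext ⟨z, π⟩
    simp
  have hq : ∀ π, Q.real {π} = ((Fintype.card (Equiv.Perm (Fin n)) : ℝ) ^ M)⁻¹ := by
    intro π
    rw [Measure.real, hQ, Measure.pi_singleton]
    simp only [PMF.toMeasure_apply_singleton _ _ (MeasurableSet.of_discrete),
      PMF.uniformOfFintype_apply, Finset.prod_const, Finset.card_univ, Fintype.card_fin,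
      ENNReal.toReal_pow, ENNReal.toReal_inv, ENNReal.toReal_natCast, inv_pow]
  have h1 : (ν.prod Q).real A ≤ ∑ π, (ν.prod Q).real ({z | (z, π) ∈ A} ×ˢ {π}) := by
    conv_lhs => rw [hA]
    exact measureReal_iUnion_fintype_le _
  refine le_trans h1 (le_of_eq ?_)
  rw [Finset.sum_div]
  refine Finset.sum_congr rfl fun π _ => ?_
  rw [measureReal_prod_prod, hq, div_eq_mul_inv]

end helpers

/-- validity of the permutation test up to the prediction error.  Under the
null model `Y = Wγ + N`, `N ~ N(0, σ_y² I_ℓ)`, with `M` uniformly random permutations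
`π_1, …, π_M` independent of `N`, `Ŷ(π_i) = Wγ̂ + P_i (Y - Wγ̂)` and the p-value
`p = (∑_i 1{T(Ŷ(π_i)) ≥ T(Y)} + 1)/(M+1)`, one has, for every `α ∈ [0,1]`,
`P(p ≤ α) ≤ α + √M ‖W(γ - γ̂)‖/(2σ_y)`. -/
theorem stmt_11 (ℓ q M : ℕ) (hℓ : 1 ≤ ℓ) (hq : 1 ≤ q) (hM : 1 ≤ M)
    (σy : ℝ) (hσy : 0 < σy) (W : Matrix (Fin ℓ) (Fin q) ℝ) (γ γhat : Fin q → ℝ)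
    (T : (Fin ℓ → ℝ) → ℝ) (hT : Measurable T)
    (ν : Measure (Fin ℓ → ℝ)) [IsProbabilityMeasure ν]
    (hν : IsGaussianVec ν 0 (σy ^ 2 • (1 : Matrix (Fin ℓ) (Fin ℓ) ℝ)))
    (P : Measure ((Fin ℓ → ℝ) × (Fin M → Equiv.Perm (Fin ℓ))))
    (hP : P = ν.prod (Measure.pi fun _ : Fin M =>
      (PMF.uniformOfFintype (Equiv.Perm (Fin ℓ))).toMeasure))
    (Y : (Fin ℓ → ℝ) × (Fin M → Equiv.Perm (Fin ℓ)) → (Fin ℓ → ℝ))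
    (hY : Y = fun ω => fun j => (W *ᵥ γ) j + ω.1 j)
    (Yhat : Fin M → (Fin ℓ → ℝ) × (Fin M → Equiv.Perm (Fin ℓ)) → (Fin ℓ → ℝ))
    (hYhat : Yhat = fun i ω => fun j =>
      (W *ᵥ γhat) j + (Y ω (ω.2 i j) - (W *ᵥ γhat) (ω.2 i j)))
    (p : (Fin ℓ → ℝ) × (Fin M → Equiv.Perm (Fin ℓ)) → ℝ)
    (hp : p = fun ω =>
      (((Finset.univ.filter fun i : Fin M => T (Y ω) ≤ T (Yhat i ω)).card : ℝ) + 1)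
        / (M + 1)) :
    ∀ α ∈ Set.Icc (0 : ℝ) 1,
      (P {ω | p ω ≤ α}).toReal ≤
        α + Real.sqrt M * Real.sqrt (∑ j, (W *ᵥ (γ - γhat)) j ^ 2) / (2 * σy) := by
  classical
  intro α hα
  set d : Fin ℓ → ℝ := W *ᵥ (γ - γhat) with hd
  have hMp : (0 : ℝ) < (M : ℝ) + 1 := by positivity
  set S : (Fin ℓ → ℝ) → ℝ := fun z => T (fun j => (W *ᵥ γhat) j + z j) with hS
  have hSm : Measurable S := hT.comp (by fun_prop)
  set B : (Fin M → Equiv.Perm (Fin ℓ)) → Set (Fin ℓ → ℝ) := fun π =>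
    {z | ((Finset.univ.filter fun i => S z ≤ S (fun j => z (π i j))).card : ℝ) + 1
      ≤ α * (M + 1)} with hB
  have hBm : ∀ π, MeasurableSet (B π) := by
    intro π
    have hf : Measurable (fun z : Fin ℓ → ℝ =>
        ((Finset.univ.filter fun i => S z ≤ S (fun j => z (π i j))).card : ℝ) + 1) := by
      have : (fun z : Fin ℓ → ℝ =>
          ((Finset.univ.filter fun i => S z ≤ S (fun j => z (π i j))).card : ℝ) + 1)
          = fun z => (∑ i, if S z ≤ S (fun j => z (π i j)) then (1 : ℝ) else 0) + 1 := by
        funext z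
        rw [Finset.sum_boole]
      rw [this]
      refine Measurable.add_const (Finset.measurable_sum _ fun i _ => ?_) 1
      refine Measurable.ite ?_ measurable_const measurable_const
      exact measurableSet_le hSm (hSm.comp (by fun_prop))
    exact measurableSet_le hf measurable_const
  have hslice : ∀ π, {z | (z, π) ∈ {ω | p ω ≤ α}} = {z | d + z ∈ B π} := by
    intro π
    ext z
    have hYe : Y (z, π) = fun j => (W *ᵥ γhat) j + (d + z) j := by
      rw [hY]
      funext j
      simp only [hd, Matrix.mulVec_sub, Pi.add_apply, Pi.sub_apply]
      ring
    have hYh : ∀ i, Yhat i (z, π) = fun j => (W *ᵥ γhat) j + (d + z) (π i j) := by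
      intro i
      rw [hYhat]
      funext j
      simp only [hYe]
      ring
    change p (z, π) ≤ α ↔ _
    rw [hp]
    simp only [hYh]
    rw [div_le_iff₀ hMp, hYe]
    rfl
  have h1 := prod_bound ν {ω | p ω ≤ α}
  rw [← hP] at h1
  simp only [hslice] at h1
  set C : ℝ := (Fintype.card (Equiv.Perm (Fin ℓ)) : ℝ) ^ M with hC
  have hCpos : 0 < C := by
    have : (0 : ℝ) < Fintype.card (Equiv.Perm (Fin ℓ)) := by exact_mod_cast Fintype.card_pos
    positivity
  set δ : ℝ := Real.sqrt (∑ j, d j ^ 2) / (2 * σy) with hδ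
  have hδ0 : 0 ≤ δ := by positivity
  have h2 : ∑ π, ν.real {z | d + z ∈ B π} ≤ ∑ π, ν.real (B π) + C * δ := by
    calc _ ≤ ∑ π, (ν.real (B π) + δ) :=
          Finset.sum_le_sum fun π _ => gauss_tv hσy hν d (hBm π)
      _ = _ := by
          rw [Finset.sum_add_distrib]
          simp [hC]
  have h3 := perm_valid M (fun g => gauss_perm hν g) B hBm S (α * (M + 1))
    (mul_nonneg hα.1 hMp.le) (fun π z => Iff.rfl)
  have h4 : ∑ π, ν.real (B π) ≤ α * C := by
    refine le_of_mul_le_mul_left ?_ hMp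
    rw [← hC] at h3
    linarith
  have hsq : 1 ≤ Real.sqrt M := by
    rw [Real.one_le_sqrt]
    exact_mod_cast hM
  have h5 : (∑ π, ν.real {z | d + z ∈ B π}) / C ≤ α + δ := by
    rw [div_le_iff₀ hCpos]
    linarith
  have h6 : δ ≤ Real.sqrt M * Real.sqrt (∑ j, d j ^ 2) / (2 * σy) := by
    rw [mul_div_assoc]
    exact le_mul_of_one_le_left hδ0 hsq
  linarith
end
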